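/- Let β = (π_ℓ)_{ℓ=1}^L be any chainable architecture of depth L ≥ 1. Then for every matrix A of the appropriate size there exist factors X_ℓ ∈ D^{π_ℓ} (ℓ = 1,…,L) such that ‖A − X₁⋯X_L‖_F ≤ √(max(L,2) − 1) · E^β(A); in particular ‖A − X₁⋯X_L‖_F ≤ (max(L,2) − 1) · E^β(A). -/

import Mathlib

/-- A *pattern* is a tuple `(a, b, c, d)` of (positive) natural numbers. -/
structure Pattern where
  a : ℕ
  b : ℕ
  c : ℕ
  d : ℕ

namespace Pattern

/-- The entries of a pattern are positive integers. -/
def Pos (π : Pattern) : Prop := 0 < π.a ∧ 0 < π.b ∧ 0 < π.c ∧ 0 < π.d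

/-- Number of rows `a*b*d` of a `π`-factor. -/
def rows (π : Pattern) : ℕ := π.a * π.b * π.d

/-- Number of columns `a*c*d` of a `π`-factor. -/
def cols (π : Pattern) : ℕ := π.a * π.c * π.d

/-- `r(π₁, π₂) = a₁c₁/a₂ (= b₂d₂/d₁)`. -/
def rk (π₁ π₂ : Pattern) : ℕ := π₁.a * π₁.c / π₂.a

/-- A pair of patterns is *chainable* if `a₁c₁/a₂ = b₂d₂/d₁` is a positive integer,
`a₁ ∣ a₂` and `d₂ ∣ d₁`. -/
def Chainable (π₁ π₂ : Pattern) : Prop :=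
  π₂.a ∣ π₁.a * π₁.c ∧ π₁.d ∣ π₂.b * π₂.d ∧
    π₁.a * π₁.c / π₂.a = π₂.b * π₂.d / π₁.d ∧
    0 < π₁.a * π₁.c / π₂.a ∧ π₁.a ∣ π₂.a ∧ π₂.d ∣ π₁.d

/-- `π₁ * π₂ := (a₁, b₁d₁/d₂, a₂c₂/a₁, d₂)`. -/
instance : Mul Pattern :=
  ⟨fun π₁ π₂ => ⟨π₁.a, π₁.b * π₁.d / π₂.d, π₂.a * π₂.c / π₁.a, π₂.d⟩⟩

/-- `‖π‖₀ := a*b*c*d`. -/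
def norm0 (π : Pattern) : ℕ := π.a * π.b * π.c * π.d

end Pattern

open scoped Kronecker

/-- The flattening equivalence `(Fin a × Fin b) × Fin d ≃ Fin (a*b*d)`. -/
def kron3Equiv (a b d : ℕ) : (Fin a × Fin b) × Fin d ≃ Fin (a * b * d) :=
  (finProdFinEquiv.prodCongr (Equiv.refl (Fin d))).trans finProdFinEquiv

/-- The support matrix `S_π = I_a ⊗ 1_{b×c} ⊗ I_d ∈ {0,1}^{abd × acd}`. -/
def Pattern.S (π : Pattern) : Matrix (Fin π.rows) (Fin π.cols) ℕ :=
  Matrix.reindex (kron3Equiv π.a π.b π.d) (kron3Equiv π.a π.c π.d)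
    ((1 : Matrix (Fin π.a) (Fin π.a) ℕ) ⊗ₖ
      (Matrix.of fun _ _ => (1 : ℕ) : Matrix (Fin π.b) (Fin π.c) ℕ) ⊗ₖ
      (1 : Matrix (Fin π.d) (Fin π.d) ℕ))

/-- The support matrix `S_π`, extended by zero to an `ℕ × ℕ`-indexed array. -/
def SpatN (π : Pattern) : ℕ → ℕ → ℕ := fun i j =>
  if h : i < π.rows ∧ j < π.cols then π.S ⟨i, h.1⟩ ⟨j, h.2⟩ else 0

/-- `X` is (the extension by zero of) a `π`-factor: it vanishes outside the support of `S_π`. -/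
def IsFactorN (π : Pattern) (X : ℕ → ℕ → ℂ) : Prop :=
  ∀ i j, SpatN π i j = 0 → X i j = 0

/-- Product of matrices encoded as finitely supported `ℕ × ℕ`-indexed arrays. -/
noncomputable def nmul (f g : ℕ → ℕ → ℂ) : ℕ → ℕ → ℂ := fun i j => ∑' k, f i k * g k j

/-- `nprod X k = X 0 * X 1 * ⋯ * X k`. -/
noncomputable def nprod (X : ℕ → ℕ → ℕ → ℂ) : ℕ → ℕ → ℕ → ℂ
  | 0 => X 0
  | k + 1 => nmul (nprod X k) (X (k + 1))

/-- Frobenius norm. -/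
noncomputable def nfrob (f : ℕ → ℕ → ℂ) : ℝ := Real.sqrt (∑' i, ∑' j, ‖f i j‖ ^ 2)

/-- `A` is (the extension by zero of) a matrix of size `m × n`. -/
def SuppIn (m n : ℕ) (A : ℕ → ℕ → ℂ) : Prop := ∀ i j, A i j ≠ 0 → i < m ∧ j < n

/-- The set `B^β` of butterfly matrices for the architecture `β = (π 0, …, π (L-1))`. -/
def Bset (π : ℕ → Pattern) (L : ℕ) : Set (ℕ → ℕ → ℂ) :=
  { M | ∃ X : ℕ → ℕ → ℕ → ℂ, (∀ ℓ < L, IsFactorN (π ℓ) (X ℓ)) ∧ M = nprod X (L - 1) }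

/-- The approximation error `E^β(A) = inf_{B ∈ B^β} ‖A - B‖_F`. -/
noncomputable def Eerr (π : ℕ → Pattern) (L : ℕ) (A : ℕ → ℕ → ℂ) : ℝ :=
  sInf { e : ℝ | ∃ B ∈ Bset π L, e = nfrob (A - B) }

section OrthogonalFrames

variable {E κ : Type*} [NormedAddCommGroup E] [InnerProductSpace ℂ E]

/-- A family is an orthogonal frame on `s` if its members there are pairwise orthogonal and each is
zero or a unit vector. -/
def IsFrameOn (s : Finset κ) (v : κ → E) : Prop :=
  (∀ k ∈ s, v k = 0 ∨ ‖v k‖ = 1) ∧ ∀ k ∈ s, ∀ k' ∈ s, k ≠ k' → inner ℂ (v k) (v k') = 0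

/-- The projection of `x` onto the span of an orthogonal frame. -/
noncomputable def frameProj (s : Finset κ) (v : κ → E) (x : E) : E :=
  ∑ k ∈ s, inner ℂ (v k) x • v k

namespace IsFrameOn

variable {s : Finset κ} {v : κ → E}

lemma inner_sum (h : IsFrameOn s v) (c : κ → ℂ) {k : κ} (hk : k ∈ s) :
    inner ℂ (v k) (∑ l ∈ s, c l • v l) = c k * inner ℂ (v k) (v k) := by
  rw [_root_.inner_sum, Finset.sum_eq_single_of_mem k hk, inner_smul_right]
  intro l hl hlk
  rw [inner_smul_right, h.2 k hk l hl hlk.symm, mul_zero]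

lemma inner_sub_frameProj (h : IsFrameOn s v) (x : E) {k : κ} (hk : k ∈ s) :
    inner ℂ (v k) (x - frameProj s v x) = 0 := by
  rw [inner_sub_right, frameProj, h.inner_sum _ hk]
  rcases h.1 k hk with h0 | h1
  · simp [h0]
  · simp [inner_self_eq_norm_sq_to_K, h1]

lemma norm_sub_sq (h : IsFrameOn s v) (x : E) {y : E} (hy : y ∈ Submodule.span ℂ (v '' s)) :
    ‖x - y‖ ^ 2 = ‖x - frameProj s v x‖ ^ 2 + ‖frameProj s v x - y‖ ^ 2 := by
  have hp : frameProj s v x ∈ Submodule.span ℂ (v '' s) :=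
    Submodule.sum_mem _ fun k hk => Submodule.smul_mem _ _ (Submodule.subset_span ⟨k, hk, rfl⟩)
  have ho : ∀ z ∈ Submodule.span ℂ (v '' s), inner ℂ z (x - frameProj s v x) = 0 := by
    intro z hz
    induction hz using Submodule.span_induction with
    | mem z hz => obtain ⟨k, hk, rfl⟩ := hz; exact h.inner_sub_frameProj x hk
    | zero => simp
    | add a b _ _ ha hb => rw [inner_add_left, ha, hb, add_zero]
    | smul c a _ ha => rw [inner_smul_left, ha, mul_zero]
  have h0 := ho _ (Submodule.sub_mem _ hp hy)
  have := norm_add_sq_eq_norm_sq_add_norm_sq_of_inner_eq_zero (𝕜 := ℂ) _ _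
    (inner_eq_zero_symm.1 h0)
  rw [sub_add_sub_cancel] at this
  simpa [sq] using this

lemma norm_sum_sq (h : IsFrameOn s v) (c : κ → ℂ) :
    ‖∑ k ∈ s, c k • v k‖ ^ 2 = ∑ k ∈ s, ‖c k‖ ^ 2 * ‖v k‖ ^ 2 := by
  have : (‖∑ k ∈ s, c k • v k‖ ^ 2 : ℂ) = ∑ k ∈ s, (‖c k‖ ^ 2 * ‖v k‖ ^ 2 : ℂ) := by
    have h1 := inner_self_eq_norm_sq_to_K (𝕜 := ℂ) (∑ k ∈ s, c k • v k)
    refine h1.symm.trans ?_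
    rw [sum_inner]
    refine Finset.sum_congr rfl fun k hk => ?_
    rw [inner_smul_left, h.inner_sum c hk, inner_self_eq_norm_sq_to_K, ← mul_assoc,
      Complex.conj_mul']
    rfl
  exact_mod_cast this

lemma norm_sum_sq_le (h : IsFrameOn s v) (c : κ → ℂ) :
    ‖∑ k ∈ s, c k • v k‖ ^ 2 ≤ ∑ k ∈ s, ‖c k‖ ^ 2 := by
  rw [h.norm_sum_sq]
  refine Finset.sum_le_sum fun k hk => ?_
  rcases h.1 k hk with h0 | h1
  · simp [h0]
  · simp [h1]

lemma sum_inner_sq_le (h : IsFrameOn s v) (x : E) :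
    ∑ k ∈ s, ‖inner ℂ (v k) x‖ ^ 2 ≤ ‖x‖ ^ 2 := by
  have h1 := h.norm_sub_sq x (Submodule.zero_mem _)
  have h2 : ‖frameProj s v x‖ ^ 2 = ∑ k ∈ s, ‖inner ℂ (v k) x‖ ^ 2 := by
    rw [frameProj, h.norm_sum_sq]
    refine Finset.sum_congr rfl fun k hk => ?_
    rcases h.1 k hk with h0 | h1
    · simp [h0]
    · simp [h1]
  rw [sub_zero, sub_zero, h2] at h1
  nlinarith [sq_nonneg ‖x - frameProj s v x‖]

end IsFrameOn

lemma exists_frame_span_eq [Finite κ] (X : κ → E) :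
    ∃ V : κ → E, (∀ k, V k = 0 ∨ ‖V k‖ = 1) ∧ (∀ k k', k ≠ k' → inner ℂ (V k) (V k') = 0) ∧
      Submodule.span ℂ (Set.range V) = Submodule.span ℂ (Set.range X) := by
  obtain ⟨n, ⟨e⟩⟩ := Finite.exists_equiv_fin κ
  refine ⟨InnerProductSpace.gramSchmidtNormed ℂ (X ∘ e.symm) ∘ e, fun k => ?_, fun k k' hkk' => ?_,
    ?_⟩
  · exact or_iff_not_imp_left.2 fun h => InnerProductSpace.gramSchmidtNormed_unit_length' h
  · simp only [Function.comp_apply, InnerProductSpace.gramSchmidtNormed]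
    rw [inner_smul_left, inner_smul_right,
      InnerProductSpace.gramSchmidt_orthogonal ℂ _ (e.injective.ne hkk'), mul_zero, mul_zero]
  · rw [e.surjective.range_comp, InnerProductSpace.span_gramSchmidtNormed_range,
      InnerProductSpace.span_gramSchmidt, e.symm.surjective.range_comp]

end OrthogonalFrames

section GroupedFrames

variable {ι : Type*} [Fintype ι]

/-- Families of vectors, the `k`-th one supported on `S k`, that are orthogonal frames on each class
of the equivalence relation `r`. -/
def groupedFrames (S : ι → ι → Prop) (r : Setoid ι) : Set (ι → EuclideanSpace ℂ ι) :=
  {V | (∀ k j, ¬ S k j → V k j = 0) ∧ (∀ k, V k = 0 ∨ ‖V k‖ = 1) ∧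
    ∀ k k', r k k' → k ≠ k' → inner ℂ (V k) (V k') = 0}

lemma isCompact_groupedFrames (S : ι → ι → Prop) (r : Setoid ι) :
    IsCompact (groupedFrames S r) := by
  refine Metric.isCompact_of_isClosed_isBounded ?_ ?_
  · simp only [groupedFrames, Set.ofPred_and, Set.ofPred_forall]
    refine IsClosed.inter ?_ (IsClosed.inter ?_ ?_)
    · exact isClosed_iInter fun k => isClosed_iInter fun j => isClosed_iInter fun _ =>
        isClosed_eq (by fun_prop) continuous_const
    · exact isClosed_iInter fun k => IsClosed.union
        (isClosed_eq (by fun_prop) continuous_const) (isClosed_eq (by fun_prop) continuous_const)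
    · exact isClosed_iInter fun k => isClosed_iInter fun k' => isClosed_iInter fun _ =>
        isClosed_iInter fun _ => isClosed_eq (by fun_prop) continuous_const
  · refine (Metric.isBounded_closedBall (x := (0 : ι → EuclideanSpace ℂ ι)) (r := 1)).subset ?_
    intro V hV
    rw [mem_closedBall_zero_iff, pi_norm_le_iff_of_nonneg zero_le_one]
    intro k
    rcases hV.2.1 k with h | h
    · simp [h]
    · exact h.le

lemma exists_groupedFrames_isMinOn (S : ι → ι → Prop) (r : Setoid ι)
    (J : (ι → EuclideanSpace ℂ ι) → ℝ) (hJ : Continuous J) :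
    ∃ V ∈ groupedFrames S r, ∀ V' ∈ groupedFrames S r, J V ≤ J V' := by
  obtain ⟨V, hV, hmin⟩ := (isCompact_groupedFrames S r).exists_isMinOn
    ⟨0, by simp [groupedFrames]⟩ hJ.continuousOn
  exact ⟨V, hV, fun V' hV' => hmin hV'⟩

/-- Gram–Schmidt inside each class. -/
lemma exists_groupedFrames_span (S : ι → ι → Prop) (r : Setoid ι)
    (hr : ∀ k k', r k k' → ∀ j, S k j ↔ S k' j) (X : ι → EuclideanSpace ℂ ι)
    (hX : ∀ k j, ¬ S k j → X k j = 0) :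
    ∃ V ∈ groupedFrames S r, ∀ k, X k ∈ Submodule.span ℂ (V '' {k' | r k' k}) := by
  choose G hG using fun q : Quotient r =>
    exists_frame_span_eq (κ := {k // Quotient.mk r k = q}) fun k => X k
  have hGk : ∀ q k (h : Quotient.mk r k = q), G _ ⟨k, rfl⟩ = G q ⟨k, h⟩ := by
    rintro _ k rfl; rfl
  refine ⟨fun k => G _ ⟨k, rfl⟩, ⟨?_, fun k => (hG _).1 _, ?_⟩, ?_⟩
  · intro k j hkj
    have hmem : G _ ⟨k, rfl⟩ ∈ Submodule.span ℂ (Set.range fun k' :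
        {k' // Quotient.mk r k' = Quotient.mk r k} => X k') := by
      rw [← (hG (Quotient.mk r k)).2.2]
      exact Submodule.subset_span ⟨_, rfl⟩
    have hle : Submodule.span ℂ (Set.range fun k' :
        {k' // Quotient.mk r k' = Quotient.mk r k} => X k') ≤
        LinearMap.ker (EuclideanSpace.proj (𝕜 := ℂ) j).toLinearMap := by
      rw [Submodule.span_le]
      rintro _ ⟨k', rfl⟩
      have := hX k' j (fun h => hkj ((hr _ _ (Quotient.exact k'.2) j).1 h))
      simpa using this
    simpa using hle hmem
  · intro k k' hkk' hne
    have h : Quotient.mk r k' = Quotient.mk r k := Quotient.sound (r.symm hkk')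
    simp only [hGk _ k' h]
    exact (hG _).2.1 _ _ (by simpa using hne)
  · intro k
    have hmem : X k ∈ Submodule.span ℂ (Set.range (G (Quotient.mk r k))) := by
      rw [(hG (Quotient.mk r k)).2.2]
      exact Submodule.subset_span ⟨⟨k, rfl⟩, rfl⟩
    refine Submodule.span_mono ?_ hmem
    rintro _ ⟨⟨k', hk'⟩, rfl⟩
    exact ⟨k', Quotient.exact hk', hGk _ _ _⟩

end GroupedFrames

section ButterflyMatrices

variable {ι : Type*}

/-- The matrix `A` vanishes outside the relation `S`. -/
def VanishesOff (S : ι → ι → Prop) (A : Matrix ι ι ℂ) : Prop := ∀ i j, ¬ S i j → A i j = 0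

/-- The support of a generic product of `n + 1` matrices with supports `S 0, …, S n`. -/
def pathSupport (S : ℕ → ι → ι → Prop) : ℕ → ι → ι → Prop
  | 0 => S 0
  | n + 1 => fun i j => ∃ k, pathSupport S n i k ∧ S (n + 1) k j

variable {S : ℕ → ι → ι → Prop}

lemma pathSupport_congr {n : ℕ} {k k' : ι} (h : ∀ i, S n i k ↔ S n i k') (i : ι) :
    pathSupport S n i k ↔ pathSupport S n i k' := by
  cases n with
  | zero => exact h i
  | succ n => simp [pathSupport, h]

/-- Two intermediate indices are interchangeable between the `n`-th and the next support. -/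
def interchangeable (S : ℕ → ι → ι → Prop) (n : ℕ) : Setoid ι where
  r k k' := (∀ i, S n i k ↔ S n i k') ∧ ∀ j, S (n + 1) k j ↔ S (n + 1) k' j
  iseqv := ⟨fun _ => ⟨fun _ => Iff.rfl, fun _ => Iff.rfl⟩,
    fun h => ⟨fun i => (h.1 i).symm, fun j => (h.2 j).symm⟩,
    fun h h' => ⟨fun i => (h.1 i).trans (h'.1 i), fun j => (h.2 j).trans (h'.2 j)⟩⟩

/-- Every entry of a product of matrices with supports `S 0, …, S (n + 1)` receives contributions
from a single class of interchangeable indices. -/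
def HasDisjointBlocks (S : ℕ → ι → ι → Prop) (n : ℕ) : Prop :=
  ∀ i j k k', pathSupport S n i k → pathSupport S n i k' → S (n + 1) k j → S (n + 1) k' j →
    interchangeable S n k k'

variable [Fintype ι]

/-- Products of `n + 1` matrices with supports `S 0, …, S n`. -/
def supportedProducts (S : ℕ → ι → ι → Prop) : ℕ → Set (Matrix ι ι ℂ)
  | 0 => {A | VanishesOff (S 0) A}
  | n + 1 => {A | ∃ C ∈ supportedProducts S n, ∃ X, VanishesOff (S (n + 1)) X ∧ A = C * X}

/-- The squared Frobenius norm. -/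
noncomputable def frobSq (A : Matrix ι ι ℂ) : ℝ := ∑ i, ∑ j, ‖A i j‖ ^ 2

lemma frobSq_eq_sum_rows (A : Matrix ι ι ℂ) : frobSq A = ∑ i, ‖WithLp.toLp 2 (A i)‖ ^ 2 := by
  simp [frobSq, EuclideanSpace.norm_sq_eq]

lemma VanishesOff.mul_right {S : ι → ι → Prop} {X G : Matrix ι ι ℂ} (hX : VanishesOff S X)
    (hG : ∀ k k', G k k' ≠ 0 → ∀ i, S i k ↔ S i k') : VanishesOff S (X * G) := by
  intro i j hij
  rw [Matrix.mul_apply]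
  refine Finset.sum_eq_zero fun k _ => ?_
  by_cases hk : G k j = 0
  · rw [hk, mul_zero]
  · rw [hX i k (fun h => hij ((hG k j hk i).1 h)), zero_mul]

lemma vanishesOff_pathSupport {n : ℕ} {A : Matrix ι ι ℂ} (hA : A ∈ supportedProducts S n) :
    VanishesOff (pathSupport S n) A := by
  induction n generalizing A with
  | zero => exact hA
  | succ n ih =>
    obtain ⟨C, hC, X, hX, rfl⟩ := hA
    intro i j hij
    rw [Matrix.mul_apply]
    refine Finset.sum_eq_zero fun k _ => ?_
    by_cases hk : pathSupport S n i k
    · rw [hX k j (fun h => hij ⟨k, hk, h⟩), mul_zero]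
    · rw [ih hC i k hk, zero_mul]

lemma mul_mem_supportedProducts {n : ℕ} {A G : Matrix ι ι ℂ} (hA : A ∈ supportedProducts S n)
    (hG : ∀ k k', G k k' ≠ 0 → ∀ i, S n i k ↔ S n i k') : A * G ∈ supportedProducts S n := by
  cases n with
  | zero => exact VanishesOff.mul_right hA hG
  | succ n =>
    obtain ⟨C, hC, X, hX, rfl⟩ := hA
    exact ⟨C, hC, X * G, hX.mul_right hG, Matrix.mul_assoc _ _ _⟩

lemma toLp_mul_row (C X : Matrix ι ι ℂ) (i : ι) :
    WithLp.toLp 2 ((C * X) i) = ∑ k, C i k • WithLp.toLp 2 (X k) := by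
  ext j
  simp [Matrix.mul_apply]

open Classical in
lemma toLp_mul_row_of_vanishesOff {T : ι → ι → Prop} {C : Matrix ι ι ℂ} (hC : VanishesOff T C)
    (X : Matrix ι ι ℂ) (i : ι) :
    WithLp.toLp 2 ((C * X) i) = ∑ k with T i k, C i k • WithLp.toLp 2 (X k) := by
  rw [toLp_mul_row, Finset.sum_filter]
  refine Finset.sum_congr rfl fun k _ => ?_
  split_ifs with h
  · rfl
  · rw [hC i k h, zero_smul]

lemma inner_eq_zero_of_disjoint {v w : EuclideanSpace ℂ ι} (h : ∀ j, v j = 0 ∨ w j = 0) :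
    inner ℂ v w = 0 := by
  rw [PiLp.inner_apply]
  refine Finset.sum_eq_zero fun j _ => ?_
  rcases h j with h | h <;> simp [h]

open Classical in
lemma HasDisjointBlocks.isFrameOn {n : ℕ} (hS : HasDisjointBlocks S n)
    {V : ι → EuclideanSpace ℂ ι} (hV : V ∈ groupedFrames (S (n + 1)) (interchangeable S n))
    (i : ι) : IsFrameOn {k | pathSupport S n i k} V := by
  refine ⟨fun k _ => hV.2.1 k, fun k hk k' hk' hne => ?_⟩
  by_cases h : interchangeable S n k k'
  · exact hV.2.2 k k' h hne
  · refine inner_eq_zero_of_disjoint fun j => ?_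
    by_contra! hj
    exact h (hS i j k k' (by simpa using hk) (by simpa using hk')
      (not_imp_comm.1 (hV.1 k j) hj.1) (not_imp_comm.1 (hV.1 k' j) hj.2))

open Classical in
/-- The coefficients of the rows of `A` along `V`, restricted to the relation `T`. -/
noncomputable def rowCoeffs (T : ι → ι → Prop) (V : ι → EuclideanSpace ℂ ι) (A : Matrix ι ι ℂ) :
    Matrix ι ι ℂ :=
  Matrix.of fun i k => if T i k then inner ℂ (V k) (WithLp.toLp 2 (A i)) else 0

lemma rowCoeffs_vanishesOff (T : ι → ι → Prop) (V : ι → EuclideanSpace ℂ ι) (A : Matrix ι ι ℂ) :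
    VanishesOff T (rowCoeffs T V A) := fun i k h => by simp [rowCoeffs, h]

open Classical in
lemma HasDisjointBlocks.rowCoeffs_mem {n : ℕ} (hS : HasDisjointBlocks S n)
    {V : ι → EuclideanSpace ℂ ι} (hV : V ∈ groupedFrames (S (n + 1)) (interchangeable S n))
    {C : Matrix ι ι ℂ} (hC : C ∈ supportedProducts S (n + 1)) :
    rowCoeffs (pathSupport S n) V C ∈ supportedProducts S n := by
  obtain ⟨C, hC, X, hX, rfl⟩ := hC
  let G : Matrix ι ι ℂ := Matrix.of fun k' k =>
    if interchangeable S n k' k then inner ℂ (V k) (WithLp.toLp 2 (X k')) else 0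
  have key : rowCoeffs (pathSupport S n) V (C * X) = C * G := by
    ext i k
    rw [rowCoeffs, Matrix.of_apply, toLp_mul_row, inner_sum, Matrix.mul_apply]
    split_ifs with hik
    · refine Finset.sum_congr rfl fun k' _ => ?_
      rw [inner_smul_right]
      by_cases hik' : pathSupport S n i k'
      · by_cases h : interchangeable S n k' k
        · simp [G, h]
        · have : inner ℂ (V k) (WithLp.toLp 2 (X k')) = 0 := by
            refine inner_eq_zero_of_disjoint fun j => ?_
            by_contra! hj
            exact h (hS i j k' k hik' hik (not_imp_comm.1 (hX k' j) hj.2)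
              (not_imp_comm.1 (hV.1 k j) hj.1))
          simp [G, h, this]
      · rw [vanishesOff_pathSupport hC i k' hik', zero_mul, zero_mul]
    · refine (Finset.sum_eq_zero fun k' _ => ?_).symm
      by_cases h : interchangeable S n k' k
      · rw [vanishesOff_pathSupport hC i k' (fun h' => hik ((pathSupport_congr h.1 i).1 h')),
          zero_mul]
      · simp [G, h]
  rw [key]
  refine mul_mem_supportedProducts hC fun k' k hk => ?_
  by_cases h : interchangeable S n k' k
  · exact h.1
  · simp [G, h] at hk

open Classical in
lemma HasDisjointBlocks.frobSq_rowCoeffs_sub_le {n : ℕ} (hS : HasDisjointBlocks S n)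
    {V : ι → EuclideanSpace ℂ ι} (hV : V ∈ groupedFrames (S (n + 1)) (interchangeable S n))
    (A C : Matrix ι ι ℂ) :
    frobSq (rowCoeffs (pathSupport S n) V A - rowCoeffs (pathSupport S n) V C) ≤
      frobSq (A - C) := by
  rw [frobSq_eq_sum_rows (A - C), frobSq]
  refine Finset.sum_le_sum fun i _ => ?_
  refine le_trans (le_of_eq ?_) ((hS.isFrameOn hV i).sum_inner_sq_le _)
  rw [Finset.sum_filter]
  refine Finset.sum_congr rfl fun k _ => ?_
  have : WithLp.toLp 2 ((A - C) i) = WithLp.toLp 2 (A i) - WithLp.toLp 2 (C i) := rfl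
  rw [this, inner_sub_right]
  simp only [rowCoeffs, Matrix.sub_apply, Matrix.of_apply]
  split_ifs <;> simp

open Classical in
/-- The total squared projResidual of the rows of `A` after projection on the rows of `V`. -/
noncomputable def projResidual (T : ι → ι → Prop) (A : Matrix ι ι ℂ) (V : ι → EuclideanSpace ℂ ι) :
    ℝ :=
  ∑ i, ‖WithLp.toLp 2 (A i) - frameProj {k | T i k} V (WithLp.toLp 2 (A i))‖ ^ 2

open Classical in
lemma HasDisjointBlocks.frobSq_sub_mul_le {n : ℕ} (hS : HasDisjointBlocks S n)
    {V : ι → EuclideanSpace ℂ ι} (hV : V ∈ groupedFrames (S (n + 1)) (interchangeable S n))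
    (A : Matrix ι ι ℂ) {B : Matrix ι ι ℂ} (hB : VanishesOff (pathSupport S n) B) :
    frobSq (A - B * Matrix.of fun k => (V k).ofLp) ≤
      projResidual (pathSupport S n) A V + frobSq (rowCoeffs (pathSupport S n) V A - B) := by
  rw [frobSq_eq_sum_rows (A - _), projResidual, frobSq, ← Finset.sum_add_distrib]
  refine Finset.sum_le_sum fun i _ => ?_
  have hF := hS.isFrameOn hV i
  have h1 : WithLp.toLp 2 ((A - B * Matrix.of fun k => (V k).ofLp) i) =
      WithLp.toLp 2 (A i) - ∑ k with pathSupport S n i k, B i k • V k :=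
    congrArg (WithLp.toLp 2 (A i) - ·)
      (toLp_mul_row_of_vanishesOff hB (Matrix.of fun k => (V k).ofLp) i)
  rw [h1, hF.norm_sub_sq _ (Submodule.sum_mem _ fun k hk =>
    Submodule.smul_mem _ _ (Submodule.subset_span ⟨k, hk, rfl⟩)), frameProj,
    ← Finset.sum_sub_distrib]
  simp only [← sub_smul]
  refine add_le_add le_rfl ?_
  refine (hF.norm_sum_sq_le _).trans ((Finset.sum_congr rfl fun k hk => ?_).trans_le
    (Finset.sum_le_sum_of_subset_of_nonneg (Finset.subset_univ {k | pathSupport S n i k})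
      fun _ _ _ => by positivity))
  simp only [Finset.mem_filter, Finset.mem_univ, true_and] at hk
  simp [rowCoeffs, hk]

open Classical in
lemma HasDisjointBlocks.exists_residual_le {n : ℕ} (hS : HasDisjointBlocks S n)
    (A : Matrix ι ι ℂ) {C : Matrix ι ι ℂ} (hC : C ∈ supportedProducts S (n + 1)) :
    ∃ V ∈ groupedFrames (S (n + 1)) (interchangeable S n),
      projResidual (pathSupport S n) A V ≤ frobSq (A - C) := by
  obtain ⟨C, hC, X, hX, rfl⟩ := hC
  obtain ⟨V, hV, hspan⟩ := exists_groupedFrames_span (S (n + 1)) (interchangeable S n)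
    (fun _ _ h => h.2) (fun k => WithLp.toLp 2 (X k)) hX
  refine ⟨V, hV, ?_⟩
  rw [frobSq_eq_sum_rows, projResidual]
  refine Finset.sum_le_sum fun i _ => ?_
  have hmem : WithLp.toLp 2 ((C * X) i) ∈
      Submodule.span ℂ (V '' ({k | pathSupport S n i k} : Finset ι)) := by
    rw [toLp_mul_row_of_vanishesOff (vanishesOff_pathSupport hC)]
    refine Submodule.sum_mem _ fun k hk => Submodule.smul_mem _ _ ?_
    refine Submodule.span_mono (Set.image_mono fun k' hk' => ?_) (hspan k)
    simp only [Finset.mem_filter, Finset.mem_univ, true_and] at hk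
    simpa using (pathSupport_congr hk'.1 i).2 hk
  have := (hS.isFrameOn hV i).norm_sub_sq (WithLp.toLp 2 (A i)) hmem
  change _ ≤ ‖WithLp.toLp 2 (A i) - WithLp.toLp 2 ((C * X) i)‖ ^ 2
  rw [this]
  exact le_add_of_nonneg_right (by positivity)

lemma HasDisjointBlocks.exists_approx_succ {n : ℕ} (hS : HasDisjointBlocks S n) {c : ℝ}
    (hc : ∀ A, VanishesOff (pathSupport S n) A →
      ∃ B ∈ supportedProducts S n, ∀ C ∈ supportedProducts S n,
        frobSq (A - B) ≤ c * frobSq (A - C)) (hc0 : 0 ≤ c) (A : Matrix ι ι ℂ) :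
    ∃ B ∈ supportedProducts S (n + 1), ∀ C ∈ supportedProducts S (n + 1),
      frobSq (A - B) ≤ (c + 1) * frobSq (A - C) := by
  obtain ⟨V, hV, hmin⟩ := exists_groupedFrames_isMinOn (S (n + 1)) (interchangeable S n)
    (projResidual (pathSupport S n) A) (by unfold projResidual frameProj; fun_prop)
  obtain ⟨B, hB, hBC⟩ := hc _ (rowCoeffs_vanishesOff (pathSupport S n) V A)
  refine ⟨_, ⟨B, hB, Matrix.of fun k => (V k).ofLp, hV.1, rfl⟩, fun C hC => ?_⟩
  obtain ⟨V', hV', hres⟩ := hS.exists_residual_le A hC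
  have h1 := hS.frobSq_sub_mul_le hV A (vanishesOff_pathSupport hB)
  have h2 := hBC _ (hS.rowCoeffs_mem hV hC)
  have h3 := mul_le_mul_of_nonneg_left (hS.frobSq_rowCoeffs_sub_le hV A C) hc0
  linarith [hmin V' hV']

theorem exists_approx_of_vanishesOff {n : ℕ} (hS : ∀ m < n, HasDisjointBlocks S m)
    (A : Matrix ι ι ℂ) (hA : VanishesOff (pathSupport S n) A) :
    ∃ B ∈ supportedProducts S n, ∀ C ∈ supportedProducts S n,
      frobSq (A - B) ≤ n * frobSq (A - C) := by
  induction n generalizing A with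
  | zero => exact ⟨A, hA, fun C _ => by simp [frobSq]⟩
  | succ n ih =>
    push_cast
    exact (hS n n.lt_succ_self).exists_approx_succ (ih fun m hm => hS m (hm.trans n.lt_succ_self))
      n.cast_nonneg A

open Classical in
theorem exists_approx {n : ℕ} (hS : ∀ m < n, HasDisjointBlocks S m) (A : Matrix ι ι ℂ) :
    ∃ B ∈ supportedProducts S n, ∀ C ∈ supportedProducts S n,
      frobSq (A - B) ≤ (max (n + 1) 2 - 1 : ℕ) * frobSq (A - C) := by
  cases n with
  | zero =>
    refine ⟨Matrix.of fun i j => if S 0 i j then A i j else 0, fun i j h => by simp [h],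
      fun C hC => ?_⟩
    norm_num
    refine Finset.sum_le_sum fun i _ => Finset.sum_le_sum fun j _ => ?_
    by_cases h : S 0 i j
    · simp [h]
    · simp [h, hC i j h]
  | succ n =>
    have h : max (n + 1 + 1) 2 - 1 = n + 1 := by omega
    rw [h]
    push_cast
    exact (hS n n.lt_succ_self).exists_approx_succ
      (exists_approx_of_vanishesOff fun m hm => hS m (hm.trans n.lt_succ_self)) n.cast_nonneg A

end ButterflyMatrices

section ZeroExtension

variable {N : ℕ}

/-- Extension of a square matrix by zero. -/
def zeroExtend (M : Matrix (Fin N) (Fin N) ℂ) : ℕ → ℕ → ℂ :=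
  fun i j => if h : i < N ∧ j < N then M ⟨i, h.1⟩ ⟨j, h.2⟩ else 0

lemma zeroExtend_apply (M : Matrix (Fin N) (Fin N) ℂ) (i j : Fin N) :
    zeroExtend M i j = M i j := by
  simp [zeroExtend]

lemma zeroExtend_of_not_lt (M : Matrix (Fin N) (Fin N) ℂ) {i j : ℕ} (h : ¬ (i < N ∧ j < N)) :
    zeroExtend M i j = 0 := by
  rw [zeroExtend, dif_neg h]

lemma exists_eq_zeroExtend {f : ℕ → ℕ → ℂ} (hf : SuppIn N N f) :
    ∃ M : Matrix (Fin N) (Fin N) ℂ, f = zeroExtend M := by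
  refine ⟨Matrix.of fun i j => f i j, ?_⟩
  ext i j
  by_cases h : i < N ∧ j < N
  · simp [zeroExtend, h]
  · rw [zeroExtend_of_not_lt _ h]
    exact not_imp_comm.1 (hf i j) h

lemma zeroExtend_sub (M M' : Matrix (Fin N) (Fin N) ℂ) :
    zeroExtend (M - M') = zeroExtend M - zeroExtend M' := by
  ext i j
  by_cases h : i < N ∧ j < N <;> simp [zeroExtend, h]

lemma tsum_eq_sum_fin {α : Type*} [AddCommMonoid α] [TopologicalSpace α] (f : ℕ → α)
    (hf : ∀ k, ¬ k < N → f k = 0) : ∑' k, f k = ∑ k : Fin N, f k := by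
  rw [tsum_eq_sum (s := Finset.range N) (fun k hk => hf k (by simpa using hk)),
    Fin.sum_univ_eq_sum_range]

lemma nmul_zeroExtend (M M' : Matrix (Fin N) (Fin N) ℂ) :
    nmul (zeroExtend M) (zeroExtend M') = zeroExtend (M * M') := by
  ext i j
  by_cases h : i < N ∧ j < N
  · lift i to Fin N using h.1
    lift j to Fin N using h.2
    rw [zeroExtend_apply, Matrix.mul_apply, nmul,
      tsum_eq_sum_fin (N := N) _ fun k hk => by
        rw [zeroExtend_of_not_lt M (fun h' => hk h'.2), zero_mul]]
    simp only [zeroExtend_apply]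
  · rw [zeroExtend_of_not_lt _ h, nmul]
    refine (tsum_congr fun k => ?_).trans tsum_zero
    by_cases hi : i < N
    · rw [zeroExtend_of_not_lt M' (fun h' => h ⟨hi, h'.2⟩), mul_zero]
    · rw [zeroExtend_of_not_lt M (fun h' => hi h'.1), zero_mul]

lemma nfrob_zeroExtend (M : Matrix (Fin N) (Fin N) ℂ) :
    nfrob (zeroExtend M) = Real.sqrt (frobSq M) := by
  rw [nfrob, frobSq, tsum_eq_sum_fin (N := N)]
  · congr 1
    refine Finset.sum_congr rfl fun i _ => ?_
    rw [tsum_eq_sum_fin (N := N)]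
    · simp only [zeroExtend_apply]
    · intro j hj
      simp [zeroExtend_of_not_lt M (fun h => hj h.2)]
  · intro i hi
    refine (tsum_congr fun j => ?_).trans tsum_zero
    simp [zeroExtend_of_not_lt M (fun h => hi h.1)]

end ZeroExtension

section Patterns

lemma Pattern.S_apply (π : Pattern) (i : Fin π.rows) (j : Fin π.cols) :
    π.S i j = if (i : ℕ) / π.d / π.b = j / π.d / π.c ∧ (i : ℕ) % π.d = j % π.d then 1 else 0 := by
  have h : π.S i j = (1 : Matrix (Fin π.a) (Fin π.a) ℕ) (Fin.divNat (n := π.b) (Fin.divNat i))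
      (Fin.divNat (n := π.c) (Fin.divNat j)) * 1 *
      (1 : Matrix (Fin π.d) (Fin π.d) ℕ) (Fin.modNat i) (Fin.modNat j) := rfl
  rw [h, Matrix.one_apply, Matrix.one_apply, mul_one, ite_and, ite_mul, one_mul, zero_mul]
  simp only [Fin.ext_iff, Fin.coe_divNat]
  rfl

lemma SpatN_ne_zero_iff (π : Pattern) (i j : ℕ) :
    SpatN π i j ≠ 0 ↔ (i < π.rows ∧ j < π.cols) ∧
      i / (π.b * π.d) = j / (π.c * π.d) ∧ i % π.d = j % π.d := by
  unfold SpatN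
  split_ifs with h
  · rw [Pattern.S_apply]
    simp [h, Nat.div_div_eq_div_mul, mul_comm π.d]
  · simp [h]

/-- The support relation of a pattern. -/
def Pattern.supp (N : ℕ) (π : Pattern) (i j : Fin N) : Prop := SpatN π i j ≠ 0

variable {N : ℕ}

lemma isFactorN_zeroExtend {π : Pattern} {X : Matrix (Fin N) (Fin N) ℂ}
    (hX : VanishesOff (π.supp N) X) : IsFactorN π (zeroExtend X) := by
  intro i j hij
  by_cases h : i < N ∧ j < N
  · rw [zeroExtend, dif_pos h]
    exact hX _ _ (not_not.2 hij)
  · exact zeroExtend_of_not_lt X h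

lemma IsFactorN.exists_eq_zeroExtend {π : Pattern} (hr : π.rows ≤ N) (hc : π.cols ≤ N)
    {X : ℕ → ℕ → ℂ} (hX : IsFactorN π X) :
    ∃ M : Matrix (Fin N) (Fin N) ℂ, VanishesOff (π.supp N) M ∧ X = zeroExtend M := by
  obtain ⟨M, rfl⟩ := _root_.exists_eq_zeroExtend (N := N) (f := X) fun i j hij => by
    have := ((SpatN_ne_zero_iff π i j).1 fun h => hij (hX i j h)).1
    exact ⟨this.1.trans_le hr, this.2.trans_le hc⟩
  refine ⟨M, fun i j hij => ?_, rfl⟩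
  exact (zeroExtend_apply M i j).symm.trans (hX i j (not_not.1 hij))

lemma nprod_congr {X Y : ℕ → ℕ → ℕ → ℂ} {n : ℕ} (h : ∀ ℓ ≤ n, X ℓ = Y ℓ) :
    nprod X n = nprod Y n := by
  induction n with
  | zero => exact h 0 le_rfl
  | succ n ih => rw [nprod, nprod, ih fun ℓ hℓ => h ℓ (hℓ.trans n.le_succ), h _ le_rfl]

lemma exists_nprod_eq_zeroExtend {π : ℕ → Pattern} {n : ℕ} {M : Matrix (Fin N) (Fin N) ℂ}
    (hM : M ∈ supportedProducts (fun ℓ => (π ℓ).supp N) n) :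
    ∃ X : ℕ → ℕ → ℕ → ℂ, (∀ ℓ ≤ n, IsFactorN (π ℓ) (X ℓ)) ∧ nprod X n = zeroExtend M := by
  induction n generalizing M with
  | zero =>
    refine ⟨fun _ => zeroExtend M, fun ℓ hℓ => ?_, rfl⟩
    obtain rfl := Nat.le_zero.1 hℓ
    exact isFactorN_zeroExtend hM
  | succ n ih =>
    obtain ⟨C, hC, Z, hZ, rfl⟩ := hM
    obtain ⟨X, hX, hXC⟩ := ih hC
    refine ⟨Function.update X (n + 1) (zeroExtend Z), fun ℓ hℓ => ?_, ?_⟩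
    · rcases hℓ.lt_or_eq with h | rfl
      · rw [Function.update_of_ne h.ne]
        exact hX ℓ (Nat.lt_succ_iff.1 h)
      · rw [Function.update_self]
        exact isFactorN_zeroExtend hZ
    · rw [nprod, Function.update_self, nprod_congr (Y := X), hXC, nmul_zeroExtend]
      intro ℓ hℓ
      rw [Function.update_of_ne (Nat.lt_succ_of_le hℓ).ne]

lemma exists_zeroExtend_eq_nprod {π : ℕ → Pattern} {n : ℕ}
    (hN : ∀ ℓ ≤ n, (π ℓ).rows ≤ N ∧ (π ℓ).cols ≤ N) {X : ℕ → ℕ → ℕ → ℂ}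
    (hX : ∀ ℓ ≤ n, IsFactorN (π ℓ) (X ℓ)) :
    ∃ M ∈ supportedProducts (fun ℓ => (π ℓ).supp N) n, nprod X n = zeroExtend M := by
  induction n with
  | zero => exact (hX 0 le_rfl).exists_eq_zeroExtend (hN 0 le_rfl).1 (hN 0 le_rfl).2
  | succ n ih =>
    obtain ⟨C, hC, hXC⟩ := ih (fun ℓ hℓ => hN ℓ (hℓ.trans n.le_succ))
      fun ℓ hℓ => hX ℓ (hℓ.trans n.le_succ)
    obtain ⟨Z, hZ, hXZ⟩ := (hX _ le_rfl).exists_eq_zeroExtend (hN _ le_rfl).1 (hN _ le_rfl).2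
    exact ⟨C * Z, ⟨C, hC, Z, hZ, rfl⟩, by rw [nprod, hXC, hXZ, nmul_zeroExtend]⟩

lemma Pattern.Chainable.dvd_mul {π₁ π₂ : Pattern} (h : π₁.Chainable π₂) (h₁ : π₁.Pos) :
    π₂.b * π₂.d ∣ π₁.c * π₁.d ∧ π₁.cols = π₂.rows := by
  obtain ⟨hac, hbd, heq, -, ⟨m, hm⟩, -⟩ := h
  have h1 := Nat.div_mul_cancel hac
  have h2 := Nat.div_mul_cancel hbd
  rw [← heq] at h2
  have h3 : π₁.a * π₁.c * π₁.d = π₂.a * π₂.b * π₂.d := by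
    rw [mul_assoc π₂.a, ← h2, ← h1]
    simp only [h1]
    conv_lhs => rw [← h1]
    ring
  refine ⟨⟨m, Nat.eq_of_mul_eq_mul_left h₁.1 ?_⟩, h3⟩
  rw [hm] at h3
  linarith

lemma pathSupport_mod_eq {π : ℕ → Pattern} {n : ℕ}
    (hd : ∀ ℓ < n, (π (ℓ + 1)).d ∣ (π ℓ).d) {i k : Fin N}
    (h : pathSupport (fun ℓ => (π ℓ).supp N) n i k) : (i : ℕ) % (π n).d = k % (π n).d := by
  induction n generalizing k with
  | zero => exact ((SpatN_ne_zero_iff _ _ _).1 h).2.2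
  | succ n ih =>
    obtain ⟨l, hl, hlk⟩ := h
    have h1 : (i : ℕ) ≡ l [MOD (π n).d] := ih (fun ℓ hℓ => hd ℓ (hℓ.trans n.lt_succ_self)) hl
    have h2 : (l : ℕ) ≡ k [MOD (π (n + 1)).d] := ((SpatN_ne_zero_iff _ _ _).1 hlk).2.2
    exact (h1.of_dvd (hd n n.lt_succ_self)).trans h2

lemma hasDisjointBlocks_supp {π : ℕ → Pattern} {n : ℕ} (hpos : (π n).Pos)
    (hch : ∀ ℓ ≤ n, (π ℓ).Chainable (π (ℓ + 1))) :
    HasDisjointBlocks (fun ℓ => (π ℓ).supp N) n := by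
  intro i j k k' hk hk' hkj hk'j
  obtain ⟨⟨t, ht⟩, hrc⟩ := (hch n le_rfl).dvd_mul hpos
  have hd : ∀ ℓ < n, (π (ℓ + 1)).d ∣ (π ℓ).d := fun ℓ hℓ => (hch ℓ hℓ.le).2.2.2.2.2
  have hmod : (k : ℕ) ≡ k' [MOD (π n).d] :=
    (pathSupport_mod_eq hd hk).symm.trans (pathSupport_mod_eq hd hk')
  have hmod' : (k : ℕ) ≡ k' [MOD (π (n + 1)).d] := hmod.of_dvd (hch n le_rfl).2.2.2.2.2
  obtain ⟨⟨hkr, -⟩, hkdiv, -⟩ := (SpatN_ne_zero_iff _ _ _).1 hkj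
  obtain ⟨⟨hkr', -⟩, hkdiv', -⟩ := (SpatN_ne_zero_iff _ _ _).1 hk'j
  have hdiv := hkdiv.trans hkdiv'.symm
  refine ⟨fun i' => ?_, fun j' => ?_⟩
  · simp only [Pattern.supp, SpatN_ne_zero_iff, hrc, hkr, hkr', ht, ← Nat.div_div_eq_div_mul _ _ t,
      hdiv, show (k : ℕ) % _ = k' % _ from hmod]
  · simp only [Pattern.supp, SpatN_ne_zero_iff, hkr, hkr', hdiv,
      show (k : ℕ) % _ = k' % _ from hmod']

end Patterns

/-- **Theorem (quasi-optimality).** For any chainable architecture of depth `L ≥ 1` and any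
target matrix `A`, there exist butterfly factors whose product approximates `A` within
`√(max(L,2) - 1) · E^β(A)`, and in particular within `(max(L,2) - 1) · E^β(A)`. -/
theorem butterfly_quasi_optimality (L : ℕ) (hL : 1 ≤ L) (π : ℕ → Pattern)
    (hPos : ∀ ℓ < L, (π ℓ).Pos)
    (hch : ∀ ℓ, ℓ + 1 < L → Pattern.Chainable (π ℓ) (π (ℓ + 1)))
    (A : ℕ → ℕ → ℂ) (hA : SuppIn (π 0).rows (π (L - 1)).cols A) :
    ∃ X : ℕ → ℕ → ℕ → ℂ, (∀ ℓ < L, IsFactorN (π ℓ) (X ℓ)) ∧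
      nfrob (A - nprod X (L - 1)) ≤
        Real.sqrt ((max L 2 - 1 : ℕ) : ℝ) * Eerr π L A ∧
      nfrob (A - nprod X (L - 1)) ≤ ((max L 2 - 1 : ℕ) : ℝ) * Eerr π L A := by
  obtain ⟨n, rfl⟩ : ∃ n, L = n + 1 := ⟨L - 1, by omega⟩
  simp only [Nat.add_sub_cancel, Nat.lt_succ_iff, Nat.succ_le_iff] at *
  obtain ⟨N, hN⟩ : ∃ N, ∀ ℓ ≤ n, (π ℓ).rows ≤ N ∧ (π ℓ).cols ≤ N := by
    refine ⟨∑ ℓ ∈ Finset.range (n + 1), ((π ℓ).rows + (π ℓ).cols), fun ℓ hℓ => ?_⟩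
    have := Finset.single_le_sum (f := fun ℓ => (π ℓ).rows + (π ℓ).cols)
      (s := Finset.range (n + 1)) (fun _ _ => Nat.zero_le _) (Finset.mem_range_succ_iff.2 hℓ)
    omega
  obtain ⟨A, rfl⟩ := exists_eq_zeroExtend (N := N) (f := A) fun i j hij =>
    ⟨(hA i j hij).1.trans_le (hN 0 n.zero_le).1, (hA i j hij).2.trans_le (hN n le_rfl).2⟩
  obtain ⟨B, hB, hBC⟩ := exists_approx (S := fun ℓ => (π ℓ).supp N) (n := n)
    (fun m hm => hasDisjointBlocks_supp (hPos m hm.le) fun ℓ hℓ => hch ℓ (by omega)) A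
  obtain ⟨X, hX, hXB⟩ := exists_nprod_eq_zeroExtend hB
  set c : ℕ := max (n + 1) 2 - 1 with hc
  have hc1 : (1 : ℝ) ≤ c := by
    have : 1 ≤ c := by omega
    exact_mod_cast this
  have hsqrt : 0 < Real.sqrt c := Real.sqrt_pos.2 (by linarith)
  have hE0 : 0 ≤ Eerr π (n + 1) (zeroExtend A) :=
    Real.sInf_nonneg (by rintro _ ⟨B, -, rfl⟩; exact Real.sqrt_nonneg _)
  have key : nfrob (zeroExtend A - nprod X n) ≤ Real.sqrt c * Eerr π (n + 1) (zeroExtend A) := by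
    rw [← div_le_iff₀' hsqrt]
    refine le_csInf ⟨_, nprod X n, ⟨X, fun ℓ hℓ => hX ℓ (Nat.lt_succ_iff.1 hℓ), rfl⟩, rfl⟩ ?_
    rintro _ ⟨_, ⟨Y, hY, rfl⟩, rfl⟩
    obtain ⟨C, hC, hYC⟩ := exists_zeroExtend_eq_nprod hN
      fun ℓ hℓ => hY ℓ (Nat.lt_succ_of_le hℓ)
    rw [div_le_iff₀' hsqrt, Nat.add_sub_cancel, hYC, hXB, ← zeroExtend_sub, ← zeroExtend_sub,
      nfrob_zeroExtend, nfrob_zeroExtend, ← Real.sqrt_mul (Nat.cast_nonneg c)]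
    exact Real.sqrt_le_sqrt (hBC C hC)
  refine ⟨X, hX, key, key.trans (mul_le_mul_of_nonneg_right ?_ hE0)⟩
  exact (Real.sqrt_le_iff).2 ⟨by linarith, by nlinarith⟩
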